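/- Let S be a positive semifield and X a left S-module with structure map a : 𝕊X → X. Then α_a is an Eilenberg–Moore 𝕊-algebra structure on the set of convex subsets of X: (i) for every finitely supported Φ : 𝒫X → S whose support consists of convex subsets, α_a(Φ) is a convex subset of X; (ii) for every convex A ⊆ X, α_a(Δ_A) = A, where Δ_A is the Dirac function at A; (iii) for every finitely supported Ξ from 𝕊(𝒫X) to S whose support consists of finitely supported functions 𝒫X → S supported on convex subsets, α_a(𝕊(α_a)(Ξ)) = α_a(μ_{𝒫X}(Ξ)). -/

import Mathlib

universe u

/-- The structure map of the free `S`-module (semimodule) monad on a left `S`-module `M`: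
`a(φ) = Σ_{x ∈ supp φ} φ(x) • x`. -/
noncomputable def structMap (S : Type*) (M : Type*) [Semiring S] [AddCommMonoid M]
    [Module S M] (φ : M →₀ S) : M :=
  φ.sum fun x s => s • x

/-- The convex closure of a subset `A` of a left `S`-module:
`conv(A) = { a(φ) | φ finitely supported, supp φ ⊆ A, Σ_x φ(x) = 1 }`. -/
def convClos (S : Type*) {M : Type*} [Semiring S] [AddCommMonoid M] [Module S M]
    (A : Set M) : Set M :=
  { m | ∃ φ : M →₀ S, ↑φ.support ⊆ A ∧ (φ.sum fun _ s => s) = 1 ∧ structMap S M φ = m }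

/-- A subset of a left `S`-module is convex if it equals its convex closure. -/
def IsConvex (S : Type*) {M : Type*} [Semiring S] [AddCommMonoid M] [Module S M]
    (A : Set M) : Prop :=
  convClos S A = A

/-- `c(Φ)`: the set of finitely supported functions of the form
`x ↦ Σ_{A ∈ supp Φ, u(A) = x} Φ(A)` for choice functions `u` with `u(A) ∈ A` on `supp Φ`. -/
noncomputable def choiceSet {S : Type*} {X : Type*} [Semiring S] (Φ : Set X →₀ S) :
    Set (X →₀ S) :=
  { φ | ∃ u : Set X → X, (∀ A ∈ Φ.support, u A ∈ A) ∧ φ = Finsupp.mapDomain u Φ }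

/-- The canonical weak distributive law `δ_X(Φ) = conv(c(Φ))`,
the convex closure being taken in the module `X →₀ S`. -/
noncomputable def deltaLaw (S : Type*) {X : Type*} [Semiring S] (Φ : Set X →₀ S) :
    Set (X →₀ S) :=
  convClos S (choiceSet Φ)

/-- `α_a(Φ) = { a(φ) | φ ∈ c(Φ) }`, where `a` is the structure map of the module `M`. -/
noncomputable def alphaMap (S : Type*) {M : Type*} [Semiring S] [AddCommMonoid M]
    [Module S M] (Φ : Set M →₀ S) : Set M :=
  structMap S M '' choiceSet Φ

/-- The Eilenberg–Moore style description of `δ_X(Φ)` via witnesses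
`ψ` finitely supported on `{(A, x) | x ∈ A}` such that
`Φ(A) = Σ_{x ∈ A} ψ(A,x)` for all `A` and `φ(x) = Σ_{A ∋ x} ψ(A,x)` for all `x`. -/
noncomputable def deltaEM (S : Type*) {X : Type*} [Semiring S] (Φ : Set X →₀ S) :
    Set (X →₀ S) :=
  { φ | ∃ ψ : (Set X × X) →₀ S,
      (∀ p ∈ ψ.support, p.2 ∈ p.1) ∧
      Finsupp.mapDomain Prod.fst ψ = Φ ∧
      Finsupp.mapDomain Prod.snd ψ = φ }

/-- The multiplication of the convex-powerset-of-semimodule monad: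
`μ(𝒜) = ⋃_{Ω ∈ 𝒜} α(Ω)`. -/
noncomputable def muC (S : Type*) {M : Type*} [Semiring S] [AddCommMonoid M] [Module S M]
    (𝒜 : Set (Set M →₀ S)) : Set M :=
  ⋃ Ω ∈ 𝒜, alphaMap S Ω

/-- The Kleisli extension `g♯` of `g : Y → C Z`:
`g♯(𝒜) = ⋃_{φ ∈ 𝒜} { Σ_{y ∈ supp φ} φ(y) • ψ_y | ψ_y ∈ g(y) }`. -/
noncomputable def kleisliExt {S : Type*} {Y Z : Type*} [Semiring S]
    (g : Y → Set (Z →₀ S)) (𝒜 : Set (Y →₀ S)) : Set (Z →₀ S) :=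
  ⋃ φ ∈ 𝒜, { χ | ∃ ψ : Y → (Z →₀ S), (∀ y ∈ φ.support, ψ y ∈ g y) ∧
      χ = ∑ y ∈ φ.support, φ y • ψ y }

theorem structMap_eq_linearCombination {S M : Type*} [Semiring S] [AddCommMonoid M]
    [Module S M] (φ : M →₀ S) : structMap S M φ = Finsupp.linearCombination S id φ := rfl

theorem mem_alphaMap_iff {S M : Type*} [Semiring S] [AddCommMonoid M] [Module S M]
    {Φ : Set M →₀ S} {m : M} :
    m ∈ alphaMap S Φ ↔ ∃ u : Set M → M, (∀ A ∈ Φ.support, u A ∈ A) ∧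
      Finsupp.linearCombination S u Φ = m := by
  constructor
  · rintro ⟨_, ⟨u, hu, rfl⟩, rfl⟩
    refine ⟨u, hu, ?_⟩
    rw [structMap_eq_linearCombination, Finsupp.linearCombination_mapDomain, Function.id_comp]
  · rintro ⟨u, hu, rfl⟩
    refine ⟨_, ⟨u, hu, rfl⟩, ?_⟩
    rw [structMap_eq_linearCombination, Finsupp.linearCombination_mapDomain, Function.id_comp]

theorem alphaMap_single_one {S M : Type*} [Semiring S] [Nontrivial S] [AddCommMonoid M]
    [Module S M] (A : Set M) : alphaMap S (Finsupp.single A (1 : S)) = A := by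
  ext m
  rw [mem_alphaMap_iff]
  constructor
  · rintro ⟨u, hu, rfl⟩
    simpa using hu A (by simp)
  · intro hm
    refine ⟨fun _ => m, fun B hB => ?_, by simp⟩
    rwa [Finset.mem_singleton.mp (Finsupp.support_single_subset hB)]

theorem subset_convClos {S M : Type*} [Semiring S] [AddCommMonoid M] [Module S M]
    (A : Set M) : A ⊆ convClos S A := by
  intro m hm
  refine ⟨Finsupp.single m 1, fun x hx => ?_, by simp, by simp [structMap]⟩
  rwa [Finset.mem_singleton.mp (Finsupp.support_single_subset (Finset.mem_coe.mp hx))]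

theorem IsConvex.sum_smul_mem {S M κ : Type*} [Semiring S] [AddCommMonoid M] [Module S M]
    {A : Set M} (hA : IsConvex S A) (t : Finset κ) (c : κ → S) (y : κ → M)
    (hc : ∑ k ∈ t, c k = 1) (hy : ∀ k ∈ t, c k ≠ 0 → y k ∈ A) :
    ∑ k ∈ t, c k • y k ∈ A := by
  classical
  rw [← show convClos S A = A from hA]
  refine ⟨∑ k ∈ t, Finsupp.single (y k) (c k), fun x hx => ?_, ?_, ?_⟩
  · rw [Finset.mem_coe, Finsupp.mem_support_iff, Finsupp.finsetSum_apply] at hx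
    obtain ⟨k, hk, hne⟩ := Finset.exists_ne_zero_of_sum_ne_zero hx
    rw [Finsupp.single_apply] at hne
    split_ifs at hne with h
    · exact h ▸ hy k hk hne
    · exact absurd rfl hne
  · rw [← hc]
    have h : ∀ φ : M →₀ S, (φ.sum fun _ s => s) =
        Finsupp.linearCombination S (fun _ => (1 : S)) φ := fun φ => by
      simp [Finsupp.linearCombination_apply]
    simp [h]
  · simp [structMap_eq_linearCombination]

/-- In a positive additive monoid, a finite sum with a nonzero term is nonzero. -/
theorem sum_ne_zero_of_mem_of_ne_zero {M κ : Type*} [AddCommMonoid M]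
    (hpos : ∀ a b : M, a + b = 0 → a = 0 ∧ b = 0) {t : Finset κ} {f : κ → M} {k : κ}
    (hk : k ∈ t) (hf : f k ≠ 0) : ∑ i ∈ t, f i ≠ 0 := by
  classical
  intro h
  rw [← Finset.add_sum_erase t f hk] at h
  exact hf (hpos _ _ h).1

/-- `α_a` sends an `S`-linear combination of functions supported on convex sets to the set of
the corresponding combinations of elements of their images. -/
theorem mem_alphaMap_sum_smul_iff {S M κ : Type*} [DivisionSemiring S] [AddCommMonoid M]
    [Module S M] (hpos : ∀ a b : S, a + b = 0 → a = 0 ∧ b = 0) (Ξ : κ →₀ S)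
    (Φ : κ → Set M →₀ S) (hΦ : ∀ k ∈ Ξ.support, ∀ A ∈ (Φ k).support, IsConvex S A) {m : M} :
    m ∈ alphaMap S (Finsupp.linearCombination S Φ Ξ) ↔
      ∃ v : κ → M, (∀ k ∈ Ξ.support, v k ∈ alphaMap S (Φ k)) ∧
        Finsupp.linearCombination S v Ξ = m := by
  classical
  set T := Finsupp.linearCombination S Φ Ξ with hT
  have hTapp : ∀ A, T A = ∑ k ∈ Ξ.support, Ξ k * Φ k A := fun A => by
    simp [hT, Finsupp.linearCombination_apply, Finsupp.sum, Finsupp.finsetSum_apply]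
  have hsupp : ∀ k ∈ Ξ.support, (Φ k).support ⊆ T.support := by
    intro k hk A hA
    rw [Finsupp.mem_support_iff, hTapp]
    exact sum_ne_zero_of_mem_of_ne_zero hpos hk
      (mul_ne_zero (Finsupp.mem_support_iff.mp hk) (Finsupp.mem_support_iff.mp hA))
  rw [mem_alphaMap_iff]
  constructor
  · rintro ⟨w, hw, rfl⟩
    refine ⟨fun k => Finsupp.linearCombination S w (Φ k), fun k hk => mem_alphaMap_iff.mpr
      ⟨w, fun A hA => hw A (hsupp k hk hA), rfl⟩, ?_⟩
    rw [hT, Finsupp.linearCombination_apply S (v := Φ), map_finsuppSum,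
      Finsupp.linearCombination_apply]
    simp only [map_smul]
  · rintro ⟨v, hv, rfl⟩
    simp only [mem_alphaMap_iff] at hv
    choose! w hw hwv using hv
    refine ⟨fun A => ∑ k ∈ Ξ.support, ((T A)⁻¹ * (Ξ k * Φ k A)) • w k A, fun A hA => ?_, ?_⟩
    · have hTA : T A ≠ 0 := Finsupp.mem_support_iff.mp hA
      have hAconv : IsConvex S A := by
        obtain ⟨k, hk, hne⟩ := Finset.exists_ne_zero_of_sum_ne_zero (hTapp A ▸ hTA)
        exact hΦ k hk A (Finsupp.mem_support_iff.mpr (right_ne_zero_of_mul hne))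
      refine hAconv.sum_smul_mem _ _ _ ?_ fun k hk hne => hw k hk A ?_
      · rw [← Finset.mul_sum, ← hTapp, inv_mul_cancel₀ hTA]
      · exact Finsupp.mem_support_iff.mpr (right_ne_zero_of_mul (right_ne_zero_of_mul hne))
    · have hsum : ∀ k ∈ Ξ.support, v k = ∑ A ∈ T.support, Φ k A • w k A := fun k hk => by
        rw [← hwv k hk, Finsupp.linearCombination_apply]
        exact Finsupp.sum_of_support_subset _ (hsupp k hk) _ (by simp)
      calc _ = ∑ A ∈ T.support, ∑ k ∈ Ξ.support, (Ξ k * Φ k A) • w k A := by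
            rw [Finsupp.linearCombination_apply, Finsupp.sum]
            refine Finset.sum_congr rfl fun A hA => ?_
            rw [Finset.smul_sum]
            refine Finset.sum_congr rfl fun k _ => ?_
            rw [smul_smul, mul_inv_cancel_left₀ (Finsupp.mem_support_iff.mp hA)]
        _ = ∑ k ∈ Ξ.support, Ξ k • v k := by
            rw [Finset.sum_comm]
            refine Finset.sum_congr rfl fun k hk => ?_
            rw [hsum k hk, Finset.smul_sum]
            simp only [mul_smul]
        _ = _ := by rw [Finsupp.linearCombination_apply, Finsupp.sum]

theorem isConvex_alphaMap {S M : Type*} [DivisionSemiring S] [AddCommMonoid M] [Module S M]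
    (hpos : ∀ a b : S, a + b = 0 → a = 0 ∧ b = 0) {Φ : Set M →₀ S}
    (hΦ : ∀ A ∈ Φ.support, IsConvex S A) : IsConvex S (alphaMap S Φ) := by
  refine Set.Subset.antisymm ?_ (subset_convClos _)
  rintro _ ⟨p, hp, hp1, rfl⟩
  have hcomb : Finsupp.linearCombination S (fun _ : M => Φ) p = Φ := by
    rw [Finsupp.linearCombination_apply, Finsupp.sum, ← Finset.sum_smul]
    exact (congrArg (· • Φ) hp1).trans (one_smul S Φ)
  rw [← hcomb, mem_alphaMap_sum_smul_iff hpos p _ fun _ _ => hΦ]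
  exact ⟨id, fun k hk => hp hk, rfl⟩

/-- `α_a` is an Eilenberg–Moore `𝕊`-algebra structure on the set of
convex subsets of the module `X`: (i) it lands in convex subsets, (ii) unit law,
(iii) multiplication law. -/
theorem alphaMap_EM_algebra {S : Type*} [DivisionSemiring S]
    (hpos : ∀ a b : S, a + b = 0 → a = 0 ∧ b = 0)
    {X : Type u} [AddCommMonoid X] [Module S X] :
    -- (i)
    (∀ Φ : Set X →₀ S, (∀ A ∈ Φ.support, IsConvex S A) → IsConvex S (alphaMap S Φ)) ∧
    -- (ii)
    (∀ A : Set X, IsConvex S A → alphaMap S (Finsupp.single A (1 : S)) = A) ∧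
    -- (iii)
    (∀ Ξ : (Set X →₀ S) →₀ S, (∀ Φ ∈ Ξ.support, ∀ A ∈ Φ.support, IsConvex S A) →
        alphaMap S (Finsupp.mapDomain (alphaMap S) Ξ)
          = alphaMap S (structMap S (Set X →₀ S) Ξ)) := by
  refine ⟨fun Φ hΦ => isConvex_alphaMap hpos hΦ, fun A _ => alphaMap_single_one A,
    fun Ξ hΞ => ?_⟩
  have hmap : Finsupp.mapDomain (alphaMap S) Ξ =
      Finsupp.linearCombination S (fun Φ => Finsupp.single (alphaMap S Φ) (1 : S)) Ξ := by
    simp [Finsupp.mapDomain, Finsupp.linearCombination_apply]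
  have hconv : ∀ Φ ∈ Ξ.support, ∀ B ∈ (Finsupp.single (alphaMap S Φ) (1 : S)).support,
      IsConvex S B := by
    intro Φ hΦ B hB
    rw [Finset.mem_singleton.mp (Finsupp.support_single_subset hB)]
    exact isConvex_alphaMap hpos (hΞ Φ hΦ)
  ext m
  rw [hmap, structMap_eq_linearCombination, mem_alphaMap_sum_smul_iff hpos Ξ _ hconv,
    mem_alphaMap_sum_smul_iff hpos Ξ id hΞ]
  simp only [alphaMap_single_one, id]
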